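/- Let S, A, T, 𝒫 be as in the MDP context. Let V1, V2 : S × 𝒫 → ℝ be mixture-affine and satisfy the generalized Bellman form with reward/discount pairs (R1, γ1) and (R2, γ2). Fix (s,a) ∈ S × A with γ1(s,a) ≠ γ2(s,a), and suppose the conflict condition holds for (V1, V2) at (s,a). Then there exist no mixture-affine V_Σ : S × 𝒫 → ℝ, reward R_Σ, discount γ_Σ, constant c ∈ ℝ, and weights w1 ≠ 0, w2 ≠ 0 such that V_Σ satisfies the generalized Bellman form with (R_Σ, γ_Σ) and V_Σ(s',Π) = c + w1·V1(s',Π) + w2·V2(s',Π) for all s' ∈ S and Π ∈ 𝒫. -/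

import Mathlib

open scoped BigOperators

/-- The one-step expected value `V̄(s,a,π) = E_{s' ~ T(s,a)}[V(s',π)]`. -/
noncomputable def Vbar {S A P : Type*} [Fintype S]
    (T : S → A → S → ℝ) (V : S → P → ℝ) (s : S) (a : A) (π : P) : ℝ :=
  ∑ s', T s a s' * V s' π

/-- `V` is mixture-affine with respect to the policy-mixing operation `mix`. -/
def MixAffine {S P : Type*} (mix : ℝ → P → P → P) (V : S → P → ℝ) : Prop :=
  ∀ (s : S) (β : ℝ), 0 ≤ β → β ≤ 1 → ∀ π ω : P,
    V s (mix β π ω) = β * V s π + (1 - β) * V s ω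

/-- `V` satisfies the generalized Bellman form with reward `R` and discount `γ`. -/
def BellmanForm {S A P : Type*} [Fintype S] (T : S → A → S → ℝ) (act : A → P → P)
    (V : S → P → ℝ) (R : S → A → ℝ) (γ : S → A → ℝ) : Prop :=
  ∀ (s : S) (a : A) (π : P), V s (act a π) = R s a + γ s a * Vbar T V s a π

/-- The conflict condition for `(V1, V2)` at `(s, a)`: there are policies `π, ω, l`
on which the one-step expected values of `V1` and `V2` are oppositely ordered, with
non-symmetric crossing points `β1 ≠ β2`. -/
def Conflict {S A P : Type*} [Fintype S]
    (T : S → A → S → ℝ) (V1 V2 : S → P → ℝ) (s : S) (a : A) : Prop :=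
  ∃ π ω l : P,
    Vbar T V1 s a π > Vbar T V1 s a l ∧ Vbar T V1 s a l > Vbar T V1 s a ω ∧
    Vbar T V2 s a ω > Vbar T V2 s a l ∧ Vbar T V2 s a l > Vbar T V2 s a π ∧
    (Vbar T V1 s a l - Vbar T V1 s a ω) / (Vbar T V1 s a π - Vbar T V1 s a ω) ≠
      (Vbar T V2 s a l - Vbar T V2 s a ω) / (Vbar T V2 s a π - Vbar T V2 s a ω)

/-- **Impossibility of Markovian aggregation (Theorem 4).** If `V1` and `V2` are
mixture-affine with generalized Bellman forms whose discounts differ at `(s, a)`, and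
the conflict condition holds at `(s, a)`, then there is no mixture-affine aggregate
value function with a generalized Bellman form that is a weighted sum (with nonzero
weights, plus a constant) of `V1` and `V2`. -/
theorem impossibility_of_markovian_aggregation
    {S A P : Type*} [Fintype S] [Nonempty S] [Fintype A] [Nonempty A]
    (T : S → A → S → ℝ)
    (hT0 : ∀ s a s', 0 ≤ T s a s') (hT1 : ∀ s a, ∑ s', T s a s' = 1)
    (act : A → P → P) (mix : ℝ → P → P → P)
    (hact_mix : ∀ (a : A) (β : ℝ) (π ω : P), act a (mix β π ω) = mix β (act a π) (act a ω))
    (V1 V2 : S → P → ℝ)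
    (haff1 : MixAffine mix V1) (haff2 : MixAffine mix V2)
    (R1 R2 γ1 γ2 : S → A → ℝ)
    (hB1 : BellmanForm T act V1 R1 γ1)
    (hB2 : BellmanForm T act V2 R2 γ2)
    (s : S) (a : A) (hγ : γ1 s a ≠ γ2 s a) (hconf : Conflict T V1 V2 s a) :
    ¬ ∃ (Vagg : S → P → ℝ) (Ragg γagg : S → A → ℝ) (c w1 w2 : ℝ),
        w1 ≠ 0 ∧ w2 ≠ 0 ∧ MixAffine mix Vagg ∧ BellmanForm T act Vagg Ragg γagg ∧
        ∀ (s' : S) (π : P), Vagg s' π = c + w1 * V1 s' π + w2 * V2 s' π := by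
  rintro ⟨Vagg, R, g, c, w1, w2, hw1, hw2, -, hB, hV⟩
  obtain ⟨p, o, l, h1, h2, h3, h4, hne⟩ := hconf
  have key : ∀ q : P, Vbar T Vagg s a q = c + w1 * Vbar T V1 s a q + w2 * Vbar T V2 s a q := by
    intro q
    have h : ∀ s', T s a s' * Vagg s' q
        = T s a s' * c + w1 * (T s a s' * V1 s' q) + w2 * (T s a s' * V2 s' q) := by
      intro s'
      rw [hV]
      ring
    unfold Vbar
    simp only [h, Finset.sum_add_distrib, ← Finset.mul_sum, ← Finset.sum_mul, hT1, one_mul]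
  have eqn : ∀ q : P, R s a + g s a * (c + w1 * Vbar T V1 s a q + w2 * Vbar T V2 s a q)
      = c + w1 * (R1 s a + γ1 s a * Vbar T V1 s a q)
        + w2 * (R2 s a + γ2 s a * Vbar T V2 s a q) := by
    intro q
    rw [← key, ← hB, hV, hB1, hB2]
  have ep := eqn p
  have eo := eqn o
  have el := eqn l
  generalize Vbar T V1 s a p = xp at *
  generalize Vbar T V1 s a o = xo at *
  generalize Vbar T V1 s a l = xl at *
  generalize Vbar T V2 s a p = yp at *
  generalize Vbar T V2 s a o = yo at *
  generalize Vbar T V2 s a l = yl at *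
  have hx : xp - xo ≠ 0 := by
    intro h
    linarith
  have hy : yp - yo ≠ 0 := by
    intro h
    linarith
  rw [Ne, div_eq_div_iff hx hy] at hne
  have hD : (xl - xo) * (yp - yo) - (yl - yo) * (xp - xo) ≠ 0 := sub_ne_zero.mpr hne
  have e1 : w1 * (g s a - γ1 s a) * ((xl - xo) * (yp - yo) - (yl - yo) * (xp - xo)) = 0 := by
    linear_combination (el - eo) * (yp - yo) - (ep - eo) * (yl - yo)
  have e2 : w2 * (g s a - γ2 s a) * ((xl - xo) * (yp - yo) - (yl - yo) * (xp - xo)) = 0 := by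
    linear_combination (ep - eo) * (xl - xo) - (el - eo) * (xp - xo)
  have g1 : g s a - γ1 s a = 0 := by simpa [hw1, hD] using e1
  have g2 : g s a - γ2 s a = 0 := by simpa [hw2, hD] using e2
  exact hγ (by linarith)
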